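/- Suppose 𝔤 is the complex simple Lie algebra of type G₂. If α, β ∈ Φ are orthogonal roots and e_α ∈ 𝔤_α, e_β ∈ 𝔤_β are nonzero root vectors, then ad(e_α + e_β)⁴ ≠ 0 in End(𝔤); in particular e_α + e_β has height at least 4. -/

import Mathlib

/- Background setup: a finite reduced crystallographic root system `Φ` with chosen
positive roots `Φ⁺` in a euclidean space `V`, the Cartan pairing, and the basic
combinatorial notions used in the statement. -/

open scoped RealInnerProductSpace

noncomputable section

variable {V : Type*} [NormedAddCommGroup V] [InnerProductSpace ℝ V]

/-- The Cartan pairing `⟨α, β⟩ = 2 (α, β) / (β, β)`. -/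
def cpair (α β : V) : ℝ := 2 * ⟪α, β⟫ / ⟪β, β⟫

/-- The reflection associated to `β`, as a linear endomorphism of `V`:
`v ↦ v - (2 (β, v)/(β, β)) • β`. -/
def reflEnd (β : V) : Module.End ℝ V :=
  LinearMap.id -
    (LinearMap.toSpanSingleton ℝ V β ∘ₗ ((2 / ⟪β, β⟫) • (innerSL ℝ β).toLinearMap))

/-- A subset of `V` is orthogonal if the Cartan pairing of any two distinct
elements vanishes. -/
def OrthogonalSet (S : Set V) : Prop := ∀ γ ∈ S, ∀ γ' ∈ S, γ ≠ γ' → cpair γ γ' = 0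

/-- A finite reduced crystallographic root system in the euclidean space `V`,
together with a choice of positive roots. -/
structure RootSystemData (V : Type*) [NormedAddCommGroup V] [InnerProductSpace ℝ V] where
  /-- the set of roots Φ -/
  roots : Set V
  /-- the set of positive roots Φ⁺ -/
  pos : Set V
  finite : roots.Finite
  ne_zero : ∀ α ∈ roots, α ≠ 0
  span_eq_top : Submodule.span ℝ roots = ⊤
  reduced : ∀ α ∈ roots, ∀ t : ℝ, t • α ∈ roots → t = 1 ∨ t = -1
  crystallographic : ∀ α ∈ roots, ∀ β ∈ roots, ∃ n : ℤ, cpair α β = (n : ℝ)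
  reflect_mem : ∀ α ∈ roots, ∀ β ∈ roots, reflEnd β α ∈ roots
  pos_subset : pos ⊆ roots
  pos_iff : ∀ α ∈ roots, (α ∈ pos ↔ ¬ (-α ∈ pos))
  pos_add : ∀ α ∈ pos, ∀ β ∈ pos, α + β ∈ roots → α + β ∈ pos

namespace RootSystemData

variable (D : RootSystemData V)

/-- Irreducibility: the roots admit no nontrivial partition into two mutually
orthogonal parts. -/
def IsIrreducible : Prop :=
  D.roots.Nonempty ∧
    ∀ s ⊆ D.roots, (∀ α ∈ s, ∀ β ∈ D.roots \ s, ⟪α, β⟫ = 0) → s = ∅ ∨ s = D.roots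

/-- An irreducible root system is not of type `G₂` iff no Cartan pairing of two
roots equals `±3`. -/
def NotG2 : Prop := ∀ α ∈ D.roots, ∀ β ∈ D.roots, cpair α β ≠ 3 ∧ cpair α β ≠ -3

/-- An irreducible root system is of type `G₂` iff some Cartan pairing of two
roots equals `±3`. -/
def IsG2 : Prop :=
  D.IsIrreducible ∧ ∃ α ∈ D.roots, ∃ β ∈ D.roots, cpair α β = 3 ∨ cpair α β = -3

/-- All roots have the same length (types A, D, E). -/
def SimplyLaced : Prop := ∀ α ∈ D.roots, ∀ β ∈ D.roots, ⟪α, α⟫ = ⟪β, β⟫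

/-- There are exactly two root lengths, with squared-length ratio 2
(types B, C, F₄). -/
def DoublyLaced : Prop :=
  (∃ α ∈ D.roots, ∃ β ∈ D.roots, ⟪β, β⟫ = 2 * ⟪α, α⟫) ∧
    ∀ α ∈ D.roots, ∀ β ∈ D.roots,
      ⟪α, α⟫ = ⟪β, β⟫ ∨ ⟪β, β⟫ = 2 * ⟪α, α⟫ ∨ ⟪α, α⟫ = 2 * ⟪β, β⟫

/-- A root of maximal length. -/
def IsLong (α : V) : Prop := α ∈ D.roots ∧ ∀ β ∈ D.roots, ⟪β, β⟫ ≤ ⟪α, α⟫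

/-- A root of minimal length. -/
def IsShort (α : V) : Prop := α ∈ D.roots ∧ ∀ β ∈ D.roots, ⟪α, α⟫ ≤ ⟪β, β⟫

/-- A set of positive roots is convex if any root which is a linear combination of
two of its elements with positive coefficients lies in it. -/
def ConvexSubset (S : Set V) : Prop :=
  ∀ α ∈ S, ∀ β ∈ S, ∀ a b : ℝ, 0 < a → 0 < b →
    a • α + b • β ∈ D.roots → a • α + b • β ∈ S

/-- A subset `Ψ ⊆ Φ⁺` is biconvex if both `Ψ` and `Φ⁺ \ Ψ` are convex. -/
def Biconvex (S : Set V) : Prop :=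
  S ⊆ D.pos ∧ D.ConvexSubset S ∧ D.ConvexSubset (D.pos \ S)

/-- A subset `Ψ ⊆ Φ⁺` is a combinatorial ideal if `α ∈ Ψ`, `β ∈ Φ⁺`, `α + β ∈ Φ⁺`
imply `α + β ∈ Ψ`. -/
def CombIdeal (S : Set V) : Prop :=
  S ⊆ D.pos ∧ ∀ α ∈ S, ∀ β ∈ D.pos, α + β ∈ D.pos → α + β ∈ S

end RootSystemData

/- The Lie-theoretic setup: a finite-dimensional complex simple Lie algebra `𝔤`
with Cartan subalgebra `𝔱`, whose root space decomposition is indexed by the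
root system `Φ ⊆ V`. -/

/-- A finite-dimensional simple complex Lie algebra `L`, together with a Cartan
subalgebra and its root space decomposition, whose root system is `Φ ⊆ V` with a
choice of positive roots (determining the Borel subalgebra `𝔟 = 𝔱 ⊕ 𝔫`). -/
structure LieRootData (V : Type*) [NormedAddCommGroup V] [InnerProductSpace ℝ V]
    (L : Type*) [LieRing L] [LieAlgebra ℂ L] extends RootSystemData V where
  /-- the Cartan subalgebra 𝔱 -/
  cartan : LieSubalgebra ℂ L
  /-- the root space 𝔤_α attached to each root α -/
  rs : V → Submodule ℂ L
  finiteDim : FiniteDimensional ℂ L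
  isSimple : LieAlgebra.IsSimple ℂ L
  isCartan : cartan.IsCartanSubalgebra
  rs_dim : ∀ α ∈ roots, Module.finrank ℂ (rs α) = 1
  sup_eq_top : cartan.toSubmodule ⊔ (⨆ α ∈ roots, rs α) = ⊤
  indep : ∀ α ∈ roots, rs α ⊓ (cartan.toSubmodule ⊔ ⨆ β ∈ roots \ {α}, rs β) = ⊥
  weight_vec : ∀ α ∈ roots, ∀ h ∈ cartan, ∀ x ∈ rs α, ∃ c : ℂ, ⁅h, x⁆ = c • x
  bracket_mem : ∀ α ∈ roots, ∀ β ∈ roots, α + β ∈ roots →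
    ∀ x ∈ rs α, ∀ y ∈ rs β, ⁅x, y⁆ ∈ rs (α + β)
  bracket_ne_zero : ∀ α ∈ roots, ∀ β ∈ roots, α + β ∈ roots →
    ∀ x ∈ rs α, x ≠ 0 → ∀ y ∈ rs β, y ≠ 0 → ⁅x, y⁆ ≠ 0
  bracket_eq_zero : ∀ α ∈ roots, ∀ β ∈ roots, α + β ∉ roots → α + β ≠ 0 →
    ∀ x ∈ rs α, ∀ y ∈ rs β, ⁅x, y⁆ = 0
  bracket_cartan_mem : ∀ α ∈ roots, ∀ x ∈ rs α, ∀ y ∈ rs (-α), ⁅x, y⁆ ∈ cartan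

namespace LieRootData

variable {L : Type*} [LieRing L] [LieAlgebra ℂ L] (D : LieRootData V L)

/-- The nilradical `𝔫 = ⊕_{α ∈ Φ⁺} 𝔤_α` of the Borel subalgebra, as a submodule. -/
def nilrad : Submodule ℂ L := ⨆ α ∈ D.pos, D.rs α

/-- The Borel subalgebra `𝔟 = 𝔱 ⊕ 𝔫`, as a submodule. -/
def borel : Submodule ℂ L := D.cartan.toSubmodule ⊔ D.nilrad

/-- The subspace `𝔞_Ψ = ⊕_{α ∈ Ψ} 𝔤_α` attached to a subset `Ψ ⊆ Φ⁺`. -/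
def aSubspace (S : Set V) : Submodule ℂ L := ⨆ α ∈ S, D.rs α

end LieRootData

/-- A subspace of `𝔫` is spherical if `ad(x)^4 = 0` for every `x` in it. -/
def IsSphericalSubspace {L : Type*} [LieRing L] [LieAlgebra ℂ L]
    (a : Submodule ℂ L) : Prop :=
  ∀ x ∈ a, (LieAlgebra.ad ℂ L x) ^ 4 = 0

/-- The height of a nilpotent element `x`: `max {n | ad(x)^n ≠ 0}`. -/
noncomputable def heightOf {L : Type*} [LieRing L] [LieAlgebra ℂ L] (x : L) : ℕ :=
  sSup {n : ℕ | (LieAlgebra.ad ℂ L x) ^ n ≠ 0}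

namespace G2Aux

section rootsys

variable {V : Type*} [NormedAddCommGroup V] [InnerProductSpace ℝ V]

lemma reflEnd_eq (x y : V) : reflEnd y x = x - (2 / ⟪y, y⟫ * ⟪y, x⟫) • y := by
  simp [reflEnd, LinearMap.toSpanSingleton]

lemma ip_pos (D : RootSystemData V) {x : V} (hx : x ∈ D.roots) : 0 < ⟪x, x⟫ :=
  real_inner_self_pos.2 (D.ne_zero x hx)

lemma refl_mem (D : RootSystemData V) {x y : V} (hx : x ∈ D.roots) (hy : y ∈ D.roots)
    (k : ℝ) (h : 2 * ⟪x, y⟫ = k * ⟪y, y⟫) : x - k • y ∈ D.roots := by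
  have h1 := D.reflect_mem x hx y hy
  rw [reflEnd_eq] at h1
  have hp := ip_pos D hy
  have : 2 / ⟪y, y⟫ * ⟪y, x⟫ = k := by
    rw [real_inner_comm x y, div_mul_eq_mul_div, h]
    field_simp
  rwa [this] at h1

lemma neg_mem (D : RootSystemData V) {x : V} (hx : x ∈ D.roots) : -x ∈ D.roots := by
  have := refl_mem D hx hx 2 rfl
  have h2 : x - (2 : ℝ) • x = -x := by module
  rwa [h2] at this

lemma cryst (D : RootSystemData V) {x y : V} (hx : x ∈ D.roots) (hy : y ∈ D.roots) :
    ∃ n : ℤ, 2 * ⟪x, y⟫ = n * ⟪y, y⟫ := by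
  obtain ⟨n, hn⟩ := D.crystallographic x hx y hy
  refine ⟨n, ?_⟩
  have hp := ip_pos D hy
  rw [cpair] at hn
  field_simp at hn
  linarith

/-- Coordinates of the twelve roots of `G₂` with respect to (short, long) simple roots. -/
def S : Finset (ℤ × ℤ) :=
  {(1, 0), (0, 1), (1, 1), (2, 1), (3, 1), (3, 2),
    (-1, 0), (0, -1), (-1, -1), (-2, -1), (-3, -1), (-3, -2)}

lemma S_orth : ∀ x ∈ S, ∀ y ∈ S,
    2 * x.1 * y.1 - 3 * (x.1 * y.2 + y.1 * x.2) + 6 * x.2 * y.2 = 0 →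
    ((2 * y.1 * y.1 - 6 * y.1 * y.2 + 6 * y.2 * y.2 =
        3 * (2 * x.1 * x.1 - 6 * x.1 * x.2 + 6 * x.2 * x.2)) ∨
      (2 * x.1 * x.1 - 6 * x.1 * x.2 + 6 * x.2 * x.2 =
        3 * (2 * y.1 * y.1 - 6 * y.1 * y.2 + 6 * y.2 * y.2))) ∧
    ∃ z ∈ S, 2 * z.1 = x.1 + y.1 ∧ 2 * z.2 = x.2 + y.2 := by
  decide

lemma small_bound (p q : ℤ)
    (h1 : p ≠ 0 → p ^ 2 + 3 * p * q + 3 * q ^ 2 ≤ |p|)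
    (h2 : p + 3 * q ≠ 0 → p ^ 2 + 3 * p * q + 3 * q ^ 2 ≤ |p + 3 * q|) :
    (p ≤ 4 ∧ -4 ≤ p) ∧ (q ≤ 4 ∧ -4 ≤ q) := by
  by_cases hp : p = 0
  · subst hp
    by_cases hq : q = 0
    · subst hq; norm_num
    · have := h2 (by omega)
      rcases abs_cases (0 + 3 * q) with h | h <;>
      · refine ⟨by norm_num, ?_, ?_⟩ <;> nlinarith
  · have h := h1 hp
    have hq : (p + 2 * q) ^ 2 * 3 + p ^ 2 ≤ 4 * |p| := by nlinarith
    have hp4 : |p| ≤ 4 := by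
      have := abs_pos.2 hp
      nlinarith [sq_abs p, sq_nonneg (p + 2 * q)]
    have h5 : (p + 2 * q) ^ 2 ≤ 4 := by nlinarith [sq_abs p, sq_nonneg (|p| - 2)]
    have h6 := abs_le.1 hp4
    have h7 : p + 2 * q ≤ 2 := by nlinarith
    have h8 : -2 ≤ p + 2 * q := by nlinarith
    omega

lemma small (p q : ℤ) (h0 : ¬ (p = 0 ∧ q = 0))
    (h1 : p ≠ 0 → p ^ 2 + 3 * p * q + 3 * q ^ 2 ≤ |p|)
    (h2 : p + 3 * q ≠ 0 → p ^ 2 + 3 * p * q + 3 * q ^ 2 ≤ |p + 3 * q|)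
    (h3 : 2 * p + 3 * q ≠ 0 → p ^ 2 + 3 * p * q + 3 * q ^ 2 ≤ |2 * p + 3 * q|) :
    (2 * p + 3 * q, p + 2 * q) ∈ S ∧
    ((p ≠ 0 ∧ p ^ 2 + 3 * p * q + 3 * q ^ 2 = |p|) ∨
     (p + 3 * q ≠ 0 ∧ p ^ 2 + 3 * p * q + 3 * q ^ 2 = |p + 3 * q|)) := by
  obtain ⟨⟨a1, a2⟩, a3, a4⟩ := small_bound p q h1 h2
  have key : ∀ p ∈ Finset.Icc (-4 : ℤ) 4, ∀ q ∈ Finset.Icc (-4 : ℤ) 4, ¬ (p = 0 ∧ q = 0) →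
    (p ≠ 0 → p ^ 2 + 3 * p * q + 3 * q ^ 2 ≤ |p|) →
    (p + 3 * q ≠ 0 → p ^ 2 + 3 * p * q + 3 * q ^ 2 ≤ |p + 3 * q|) →
    (2 * p + 3 * q ≠ 0 → p ^ 2 + 3 * p * q + 3 * q ^ 2 ≤ |2 * p + 3 * q|) →
    (2 * p + 3 * q, p + 2 * q) ∈ S ∧
    ((p ≠ 0 ∧ p ^ 2 + 3 * p * q + 3 * q ^ 2 = |p|) ∨
     (p + 3 * q ≠ 0 ∧ p ^ 2 + 3 * p * q + 3 * q ^ 2 = |p + 3 * q|)) := by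
    decide +kernel
  exact key p (Finset.mem_Icc.2 ⟨a2, a1⟩) q (Finset.mem_Icc.2 ⟨a4, a3⟩) h0 h1 h2 h3

/-- A `G₂` pair: `b` short, `a` long. -/
lemma exists_pair (D : RootSystemData V) (h : D.IsG2) :
    ∃ a ∈ D.roots, ∃ b ∈ D.roots, ⟪a, a⟫ = 3 * ⟪b, b⟫ ∧ 2 * ⟪a, b⟫ = -3 * ⟪b, b⟫ := by
  obtain ⟨-, a, ha, b, hb, hab⟩ := h
  have hbp := ip_pos D hb
  have main : ∀ a ∈ D.roots, 2 * ⟪a, b⟫ = -3 * ⟪b, b⟫ → ⟪a, a⟫ = 3 * ⟪b, b⟫ := by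
    intro a ha h
    have hap := ip_pos D ha
    obtain ⟨m, hm⟩ := cryst D hb ha
    rw [real_inner_comm] at hm
    have cs := real_inner_mul_inner_self_le a b
    have hA : 9 * ⟪b, b⟫ ≤ 4 * ⟪a, a⟫ := by
      have : ⟪a, b⟫ = -3 * ⟪b, b⟫ / 2 := by linarith
      rw [this] at cs
      have : (9 * ⟪b, b⟫) * ⟪b, b⟫ ≤ (4 * ⟪a, a⟫) * ⟪b, b⟫ := by nlinarith
      exact le_of_mul_le_mul_right this hbp
    have m1 : m < 0 := by
      by_contra hc
      have : (0 : ℝ) ≤ m := by exact_mod_cast not_lt.1 hc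
      nlinarith [mul_nonneg this hap.le]
    have m2 : -2 < m := by
      by_contra hc
      have : (m : ℝ) ≤ -2 := by exact_mod_cast not_lt.1 hc
      nlinarith
    have : m = -1 := by omega
    subst this
    push_cast at hm
    linarith
  rcases hab with h | h
  · have h' : 2 * ⟪-a, b⟫ = -3 * ⟪b, b⟫ := by
      rw [cpair] at h
      field_simp at h
      rw [inner_neg_left]; linarith
    exact ⟨-a, neg_mem D ha, b, hb, main _ (neg_mem D ha) h', h'⟩
  · have h' : 2 * ⟪a, b⟫ = -3 * ⟪b, b⟫ := by
      rw [cpair] at h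
      field_simp at h
      linarith
    exact ⟨a, ha, b, hb, main _ ha h', h'⟩

section pair

lemma S_root (D : RootSystemData V) {a b : V} (ha : a ∈ D.roots) (hb : b ∈ D.roots)
    (haa : ⟪a, a⟫ = 3 * ⟪b, b⟫) (hab : 2 * ⟪a, b⟫ = -3 * ⟪b, b⟫)
    (x : ℤ × ℤ) (hx : x ∈ S) : (x.1 : ℝ) • b + (x.2 : ℝ) • a ∈ D.roots := by
  have hba : ⟪b, a⟫ = ⟪a, b⟫ := real_inner_comm _ _
  have r1 : (3 : ℝ) • b + a ∈ D.roots := by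
    have := refl_mem D ha hb (-3) hab
    convert this using 1; module
  have r2 : b + a ∈ D.roots := by
    have := refl_mem D hb ha (-1) (by linarith)
    convert this using 1; module
  have r3 : (3 : ℝ) • b + (2 : ℝ) • a ∈ D.roots := by
    have := refl_mem D r1 ha (-1) (by
      simp only [inner_add_left, inner_smul_left, conj_trivial]; linarith)
    convert this using 1; module
  have r4 : (2 : ℝ) • b + a ∈ D.roots := by
    have := refl_mem D r2 hb (-1) (by
      simp only [inner_add_left, inner_smul_left, conj_trivial]; linarith)
    convert this using 1; module
  simp only [S, Finset.mem_insert, Finset.mem_singleton] at hx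
  rcases hx with h | h | h | h | h | h | h | h | h | h | h | h <;> subst h
  · convert hb using 1; push_cast; module
  · convert ha using 1; push_cast; module
  · convert r2 using 1; push_cast; module
  · convert r4 using 1; push_cast; module
  · convert r1 using 1; push_cast; module
  · convert r3 using 1; push_cast; module
  · convert neg_mem D hb using 1; push_cast; module
  · convert neg_mem D ha using 1; push_cast; module
  · convert neg_mem D r2 using 1; push_cast; module
  · convert neg_mem D r4 using 1; push_cast; module
  · convert neg_mem D r1 using 1; push_cast; module
  · convert neg_mem D r3 using 1; push_cast; module

lemma dichotomy (D : RootSystemData V) {a b : V} (ha : a ∈ D.roots) (hb : b ∈ D.roots)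
    (haa : ⟪a, a⟫ = 3 * ⟪b, b⟫) (hab : 2 * ⟪a, b⟫ = -3 * ⟪b, b⟫)
    (c : V) (hc : c ∈ D.roots) :
    (∃ x ∈ S, c = (x.1 : ℝ) • b + (x.2 : ℝ) • a) ∨ (⟪c, b⟫ = 0 ∧ ⟪c, a⟫ = 0) := by
  have hw := ip_pos D hb
  have hN := ip_pos D hc
  obtain ⟨p, hp⟩ := cryst D hc hb
  obtain ⟨q, hq⟩ := cryst D hc ha
  rw [haa] at hq
  set w := ⟪b, b⟫ with hwdef
  set N := ⟪c, c⟫ with hNdef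
  have hcb : ⟪c, b⟫ = p * w / 2 := by linarith
  have hca : ⟪c, a⟫ = 3 * q * w / 2 := by linarith
  have hbc : ⟪b, c⟫ = p * w / 2 := by rw [real_inner_comm]; exact hcb
  have hac : ⟪a, c⟫ = 3 * q * w / 2 := by rw [real_inner_comm]; exact hca
  have hab' : ⟪a, b⟫ = -3 * w / 2 := by linarith
  have hba : ⟪b, a⟫ = -3 * w / 2 := by rw [real_inner_comm]; exact hab'
  by_cases h0 : p = 0 ∧ q = 0
  · right
    rw [hcb, hca, h0.1, h0.2]; simp
  left
  have hdist : ⟪c - (((2 * p + 3 * q : ℤ) : ℝ) • b + ((p + 2 * q : ℤ) : ℝ) • a),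
      c - (((2 * p + 3 * q : ℤ) : ℝ) • b + ((p + 2 * q : ℤ) : ℝ) • a)⟫ =
      N - w * ((p ^ 2 + 3 * p * q + 3 * q ^ 2 : ℤ) : ℝ) := by
    simp only [inner_sub_left, inner_sub_right, inner_add_left, inner_add_right,
      inner_smul_left, inner_smul_right, conj_trivial, hcb, hca, hbc, hac, hab', hba, haa,
      ← hwdef, ← hNdef]
    push_cast
    ring
  have hQ : w * ((p ^ 2 + 3 * p * q + 3 * q ^ 2 : ℤ) : ℝ) ≤ N := by
    have := @real_inner_self_nonneg V _ _
      (c - (((2 * p + 3 * q : ℤ) : ℝ) • b + ((p + 2 * q : ℤ) : ℝ) • a))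
    linarith
  have bound : ∀ s ∈ D.roots, ∀ k : ℤ, ⟪s, c⟫ = k * w / 2 → k ≠ 0 → N ≤ w * ((|k| : ℤ) : ℝ) := by
    intro s hs k hk hk0
    obtain ⟨n, hn⟩ := cryst D hs hc
    rw [hk] at hn
    have hn' : (k : ℝ) * w = n * N := by linarith
    have hn0 : n ≠ 0 := by
      rintro rfl
      have : (k : ℝ) ≠ 0 := by exact_mod_cast hk0
      have := mul_ne_zero this hw.ne'
      exact this (by rw [hn']; simp)
    have h1 : (1 : ℝ) ≤ |(n : ℝ)| := by exact_mod_cast Int.one_le_abs hn0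
    have h2 : |(k : ℝ)| * w = |(n : ℝ)| * N := by
      have := congrArg abs hn'
      rwa [abs_mul, abs_mul, abs_of_pos hw, abs_of_pos hN] at this
    push_cast
    nlinarith
  have b1 := bound b hb p hbc
  have b2 := bound (b + a) (by simpa using S_root D ha hb haa hab (1, 1) (by decide)) (p + 3 * q)
    (by rw [inner_add_left, hbc, hac]; push_cast; ring)
  have b3 := bound ((2 : ℝ) • b + a) (by simpa using S_root D ha hb haa hab (2, 1) (by decide))
    (2 * p + 3 * q)
    (by rw [inner_add_left, inner_smul_left, hbc, hac, conj_trivial]; push_cast; ring)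
  have conv : ∀ m k : ℤ, w * (m : ℝ) ≤ w * (k : ℝ) → m ≤ k := by
    intro m k h
    exact_mod_cast le_of_mul_le_mul_left h hw
  obtain ⟨hS, heq⟩ := small p q h0 (fun h => conv _ _ (hQ.trans (b1 h)))
    (fun h => conv _ _ (hQ.trans (b2 h))) (fun h => conv _ _ (hQ.trans (b3 h)))
  refine ⟨_, hS, ?_⟩
  have hle : N ≤ w * ((p ^ 2 + 3 * p * q + 3 * q ^ 2 : ℤ) : ℝ) := by
    rcases heq with ⟨h, h'⟩ | ⟨h, h'⟩
    · rw [h']; exact b1 h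
    · rw [h']; exact b2 h
  rw [← sub_eq_zero, ← inner_self_eq_zero (𝕜 := ℝ), hdist]
  linarith

lemma all_roots (D : RootSystemData V) {a b : V} (ha : a ∈ D.roots) (hb : b ∈ D.roots)
    (haa : ⟪a, a⟫ = 3 * ⟪b, b⟫) (hab : 2 * ⟪a, b⟫ = -3 * ⟪b, b⟫)
    (hirr : D.IsIrreducible) (c : V) (hc : c ∈ D.roots) :
    ∃ x ∈ S, c = (x.1 : ℝ) • b + (x.2 : ℝ) • a := by
  have := hirr.2 {c | ∃ x ∈ S, c = (x.1 : ℝ) • b + (x.2 : ℝ) • a} (by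
    rintro _ ⟨x, hx, rfl⟩
    exact S_root D ha hb haa hab x hx) (by
    rintro _ ⟨x, hx, rfl⟩ d ⟨hd, hd'⟩
    rcases dichotomy D ha hb haa hab d hd with h | ⟨h1, h2⟩
    · exact absurd h hd'
    · rw [real_inner_comm, inner_add_right, inner_smul_right, inner_smul_right, h1, h2]
      simp)
  rcases this with h | h
  · exfalso
    have : b ∈ (∅ : Set V) := by
      rw [← h]
      exact ⟨(1, 0), by decide, by simp⟩
    exact this
  · rw [← h] at hc
    exact hc

end pair

lemma orth_pair (D : RootSystemData V) (h : D.IsG2) {α β : V} (hα : α ∈ D.roots)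
    (hβ : β ∈ D.roots) (horth : ⟪α, β⟫ = 0) :
    (⟪β, β⟫ = 3 * ⟪α, α⟫ ∨ ⟪α, α⟫ = 3 * ⟪β, β⟫) ∧ (1 / 2 : ℝ) • (α + β) ∈ D.roots := by
  obtain ⟨a, ha, b, hb, haa, hab⟩ := exists_pair D h
  obtain ⟨x, hx, rfl⟩ := all_roots D ha hb haa hab h.1 α hα
  obtain ⟨y, hy, rfl⟩ := all_roots D ha hb haa hab h.1 β hβ
  have hw := ip_pos D hb
  have form : ∀ x y : ℤ × ℤ, ⟪(x.1 : ℝ) • b + (x.2 : ℝ) • a, (y.1 : ℝ) • b + (y.2 : ℝ) • a⟫ =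
      ⟪b, b⟫ / 2 *
      ((2 * x.1 * y.1 - 3 * (x.1 * y.2 + y.1 * x.2) + 6 * x.2 * y.2 : ℤ) : ℝ) := by
    intro x y
    have hab' : ⟪a, b⟫ = -3 * ⟪b, b⟫ / 2 := by linarith
    have hba : ⟪b, a⟫ = -3 * ⟪b, b⟫ / 2 := by rw [real_inner_comm]; exact hab'
    simp only [inner_add_left, inner_add_right,
      inner_smul_left, inner_smul_right, conj_trivial, hab', hba, haa]
    push_cast
    ring
  rw [form] at horth
  have h0 : 2 * x.1 * y.1 - 3 * (x.1 * y.2 + y.1 * x.2) + 6 * x.2 * y.2 = 0 := by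
    rcases mul_eq_zero.1 horth with h | h
    · linarith
    · exact_mod_cast h
  obtain ⟨h1, z, hz, hz1, hz2⟩ := S_orth x hx y hy h0
  constructor
  · rw [form, form]
    rcases h1 with h1 | h1
    · left
      have h1' := congrArg (Int.cast : ℤ → ℝ) h1
      push_cast at h1' ⊢
      linear_combination (⟪b, b⟫ / 2) * h1'
    · right
      have h1' := congrArg (Int.cast : ℤ → ℝ) h1
      push_cast at h1' ⊢
      linear_combination (⟪b, b⟫ / 2) * h1'
  · have := S_root D ha hb haa hab z hz
    convert this using 1
    have e1 : (x.1 : ℝ) = 2 * z.1 - y.1 := by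
      have := congrArg (Int.cast : ℤ → ℝ) hz1
      push_cast at this; linarith
    have e2 : (x.2 : ℝ) = 2 * z.2 - y.2 := by
      have := congrArg (Int.cast : ℤ → ℝ) hz2
      push_cast at this; linarith
    rw [e1, e2]
    module

end rootsys

section lie

variable {V : Type*} [NormedAddCommGroup V] [InnerProductSpace ℝ V]
  {L : Type*} [LieRing L] [LieAlgebra ℂ L]

lemma ad_nilp (D : LieRootData V L) {α : V} (hα : α ∈ D.roots) {e : L} (he : e ∈ D.rs α) :
    IsNilpotent (LieAlgebra.ad ℂ L e) := by
  have := D.finiteDim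
  set E := LieAlgebra.ad ℂ L e with hE
  have hα0 := D.ne_zero α hα
  have step : ∀ x : L, (∃ n : ℕ, (E ^ n) ⁅e, x⁆ = 0) → ∃ n : ℕ, (E ^ n) x = 0 := by
    rintro x ⟨n, hn⟩
    exact ⟨n + 1, by rw [pow_succ]; exact hn⟩
  have hee : ∀ x ∈ D.rs α, ⁅e, x⁆ = 0 := by
    intro x hx
    refine D.bracket_eq_zero α hα α hα ?_ ?_ e he x hx
    · intro h
      have h2 : (2 : ℝ) • α ∈ D.roots := by rwa [two_smul]
      rcases D.reduced α hα 2 h2 with h | h <;> norm_num at h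
    · rw [← two_smul ℝ α]
      exact smul_ne_zero two_ne_zero hα0
  have hcart : ∀ h ∈ D.cartan, ∃ n : ℕ, (E ^ n) h = 0 := by
    intro h hh
    obtain ⟨c, hc⟩ := D.weight_vec α hα h hh e he
    apply step
    rw [← lie_skew, hc]
    refine ⟨1, ?_⟩
    simp [hE]
  have hroot : ∀ γ ∈ D.roots, ∀ x ∈ D.rs γ, ∃ n : ℕ, (E ^ n) x = 0 := by
    by_contra hcon
    push Not at hcon
    obtain ⟨γ, hγ, x, hx, hn⟩ := hcon
    have chain : ∀ k : ℕ, γ + (k : ℝ) • α ∈ D.roots ∧ ∃ y ∈ D.rs (γ + (k : ℝ) • α),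
        ¬ ∃ n : ℕ, (E ^ n) y = 0 := by
      intro k
      induction k with
      | zero => 
        simp only [Nat.cast_zero, zero_smul, add_zero]
        exact ⟨hγ, x, hx, by push Not; exact hn⟩
      | succ k ih =>
        obtain ⟨hk, y, hy, hny⟩ := ih
        have hny' : ¬ ∃ n : ℕ, (E ^ n) ⁅e, y⁆ = 0 := fun h => hny (step y h)
        have heq : γ + ((k + 1 : ℕ) : ℝ) • α = α + (γ + (k : ℝ) • α) := by
          push_cast; module
        rw [heq]
        by_cases hr : α + (γ + (k : ℝ) • α) ∈ D.roots
        · exact ⟨hr, _, D.bracket_mem α hα _ hk hr e he y hy, hny'⟩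
        · exfalso
          apply hny'
          by_cases hz : α + (γ + (k : ℝ) • α) = 0
          · apply hcart
            have : γ + (k : ℝ) • α = -α := (neg_eq_of_add_eq_zero_right hz).symm
            rw [this] at hy
            exact D.bracket_cartan_mem α hα e he y hy
          · exact ⟨0, by rw [D.bracket_eq_zero α hα _ hk hr hz e he y hy]; simp⟩
    have hinj : Function.Injective (fun k : ℕ => γ + (k : ℝ) • α) := by
      intro i j hij
      have h1 : (i : ℝ) • α = (j : ℝ) • α := add_left_cancel hij
      exact_mod_cast smul_left_injective ℝ hα0 h1
    exact Set.infinite_of_injective_forall_mem hinj (fun k => (chain k).1) D.finite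
  rw [Module.End.isNilpotent_iff_of_finite]
  have htop : (⊤ : Submodule ℂ L) ≤ E.maxGenEigenspace 0 := by
    rw [← D.sup_eq_top]
    refine sup_le ?_ (iSup₂_le ?_)
    · intro h hh
      rw [Module.End.mem_maxGenEigenspace]
      simpa using hcart h hh
    · intro γ hγ x hx
      rw [Module.End.mem_maxGenEigenspace]
      simpa using hroot γ hγ x hx
  intro x
  have := htop (Submodule.mem_top (x := x))
  rw [Module.End.mem_maxGenEigenspace] at this
  simpa using this

lemma core (D : LieRootData V L) {α β : V} (hα : α ∈ D.roots) (hβ : β ∈ D.roots)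
    (horth : ⟪α, β⟫ = 0) (hlen : ⟪β, β⟫ = 3 * ⟪α, α⟫)
    (hmid : (1 / 2 : ℝ) • (α + β) ∈ D.roots)
    {e f : L} (he : e ∈ D.rs α) (he0 : e ≠ 0) (hf : f ∈ D.rs β) (hf0 : f ≠ 0) :
    (LieAlgebra.ad ℂ L (e + f)) ^ 4 ≠ 0 ∧ 4 ≤ heightOf (e + f) := by
  have hA := ip_pos D.toRootSystemData hα
  have horth' : ⟪β, α⟫ = 0 := by rw [real_inner_comm]; exact horth
  have form : ∀ r s t u : ℝ, ⟪r • α + s • β, t • α + u • β⟫ = (r * t + 3 * s * u) * ⟪α, α⟫ := by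
    intro r s t u
    simp only [inner_add_left, inner_add_right,
      inner_smul_left, inner_smul_right, conj_trivial, horth, horth', hlen]
    ring
  have hα' : (1 : ℝ) • α + (0 : ℝ) • β ∈ D.roots := by simpa using hα
  have hβ' : (0 : ℝ) • α + (1 : ℝ) • β ∈ D.roots := by simpa using hβ
  have hmid' : (1 / 2 : ℝ) • α + (1 / 2 : ℝ) • β ∈ D.roots := by rwa [← smul_add]
  have refl : ∀ r s t u k : ℝ, r • α + s • β ∈ D.roots → t • α + u • β ∈ D.roots →
      2 * (r * t + 3 * s * u) = k * (t * t + 3 * u * u) →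
      (r - k * t) • α + (s - k * u) • β ∈ D.roots := by
    intro r s t u k h1 h2 h
    have := refl_mem D.toRootSystemData h1 h2 k (by rw [form, form]; linear_combination ⟪α, α⟫ * h)
    convert this using 1
    module
  -- all the roots needed
  have m11 : (-1 / 2 : ℝ) • α + (1 / 2 : ℝ) • β ∈ D.roots := by
    convert refl _ _ _ _ 1 hmid' hα' (by norm_num) using 3 <;> norm_num
  have n31 : (-3 / 2 : ℝ) • α + (-1 / 2 : ℝ) • β ∈ D.roots := by
    convert refl _ _ _ _ 3 hβ' hmid' (by norm_num) using 3 <;> norm_num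
  have neg : ∀ r s : ℝ, r • α + s • β ∈ D.roots → (-r) • α + (-s) • β ∈ D.roots := by
    intro r s h
    convert neg_mem D.toRootSystemData h using 1
    module
  have p31 : (3 / 2 : ℝ) • α + (1 / 2 : ℝ) • β ∈ D.roots := by
    convert neg _ _ n31 using 3 <;> norm_num
  have m31 : (-3 / 2 : ℝ) • α + (1 / 2 : ℝ) • β ∈ D.roots := by
    convert refl _ _ _ _ (-1) n31 hβ' (by norm_num) using 3 <;> norm_num
  have q31 : (3 / 2 : ℝ) • α + (-1 / 2 : ℝ) • β ∈ D.roots := by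
    convert neg _ _ m31 using 3 <;> norm_num
  have q11 : (1 / 2 : ℝ) • α + (-1 / 2 : ℝ) • β ∈ D.roots := by
    convert neg _ _ m11 using 3 <;> norm_num
  have n11 : (-1 / 2 : ℝ) • α + (-1 / 2 : ℝ) • β ∈ D.roots := by
    convert neg _ _ hmid' using 3 <;> norm_num
  -- bracket rules
  have addα : ∀ r s : ℝ, α + (r • α + s • β) = (r + 1) • α + s • β := by intros; module
  have addβ : ∀ r s : ℝ, β + (r • α + s • β) = r • α + (s + 1) • β := by intros; module
  have be : ∀ r s r' : ℝ, r + 1 = r' → r • α + s • β ∈ D.roots → r' • α + s • β ∈ D.roots →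
      ∀ x ∈ D.rs (r • α + s • β), ⁅e, x⁆ ∈ D.rs (r' • α + s • β) ∧ (x ≠ 0 → ⁅e, x⁆ ≠ 0) := by
    rintro r s _ rfl h1 h2 x hx
    rw [← addα] at h2 ⊢
    exact ⟨D.bracket_mem _ hα _ h1 h2 e he x hx,
      fun h => D.bracket_ne_zero _ hα _ h1 h2 e he he0 x hx h⟩
  have bf : ∀ r s s' : ℝ, s + 1 = s' → r • α + s • β ∈ D.roots → r • α + s' • β ∈ D.roots →
      ∀ x ∈ D.rs (r • α + s • β), ⁅f, x⁆ ∈ D.rs (r • α + s' • β) ∧ (x ≠ 0 → ⁅f, x⁆ ≠ 0) := by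
    rintro r s _ rfl h1 h2 x hx
    rw [← addβ] at h2 ⊢
    exact ⟨D.bracket_mem _ hβ _ h1 h2 f hf x hx,
      fun h => D.bracket_ne_zero _ hβ _ h1 h2 f hf hf0 x hx h⟩
  have nz : ∀ r s : ℝ, 0 < r * r + 3 * s * s → r • α + s • β ≠ 0 := by
    intro r s h h0
    have := form r s r s
    rw [h0, inner_zero_left] at this
    have := mul_pos h hA
    linarith
  -- non-roots
  have nonroot : ∀ r s : ℝ, 0 < r * r + 3 * s * s →
      (∀ n : ℤ, 2 * r ≠ n * (r * r + 3 * s * s)) → r • α + s • β ∉ D.roots := by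
    intro r s h hn hr
    obtain ⟨n, h2⟩ := cryst D.toRootSystemData hα' hr
    rw [form, form] at h2
    apply hn n
    have : (2 * r) * ⟪α, α⟫ = (n * (r * r + 3 * s * s)) * ⟪α, α⟫ := by linear_combination h2
    exact mul_right_cancel₀ hA.ne' this
  have hef : ⁅e, f⁆ = 0 := by
    have h1 : α + β = (1 : ℝ) • α + (1 : ℝ) • β := by simp
    refine D.bracket_eq_zero α hα β hβ ?_ ?_ e he f hf
    · rw [h1]
      refine nonroot _ _ (by norm_num) ?_
      intro n hn
      have : (4 * n : ℤ) = 2 := by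
        have : (4 * n : ℝ) = 2 := by linarith
        exact_mod_cast this
      omega
    · rw [h1]; exact nz _ _ (by norm_num)
  have hlast : ∀ x ∈ D.rs ((3 / 2 : ℝ) • α + (-1 / 2 : ℝ) • β), ⁅e, x⁆ = 0 := by
    intro x hx
    refine D.bracket_eq_zero _ hα _ q31 ?_ ?_ e he x hx
    · rw [addα]
      refine nonroot _ _ (by norm_num) ?_
      intro n hn
      have : (7 * n : ℤ) = 5 := by
        have : (7 * n : ℝ) = 5 := by linarith
        exact_mod_cast this
      omega
    · rw [addα]; exact nz _ _ (by norm_num)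
  have hlastf : ∀ x ∈ D.rs ((-3 / 2 : ℝ) • α + (1 / 2 : ℝ) • β), ⁅f, x⁆ = 0 := by
    intro x hx
    refine D.bracket_eq_zero _ hβ _ m31 ?_ ?_ f hf x hx
    · rw [addβ]
      intro h
      have h3 : (3 : ℝ) • ((-1 / 2 : ℝ) • α + (1 / 2 : ℝ) • β) ∈ D.roots := by
        convert h using 1; module
      rcases D.reduced _ m11 3 h3 with h | h <;> norm_num at h
    · rw [addβ]; exact nz _ _ (by norm_num)
  -- the vector
  obtain ⟨x, hx, hx0⟩ : ∃ x ∈ D.rs ((-3 / 2 : ℝ) • α + (-1 / 2 : ℝ) • β), x ≠ 0 := by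
    apply Submodule.exists_mem_ne_zero_of_ne_bot
    intro h
    have := D.rs_dim _ n31
    rw [h] at this
    simp at this
  set E := LieAlgebra.ad ℂ L e with hE
  set F := LieAlgebra.ad ℂ L f with hF
  have hcomm : Commute E F := by
    refine LinearMap.ext fun y => ?_
    change ⁅e, ⁅f, y⁆⁆ = ⁅f, ⁅e, y⁆⁆
    rw [leibniz_lie e f y, hef, zero_lie, zero_add]
  have hEF : LieAlgebra.ad ℂ L (e + f) = E + F := map_add _ _ _
  obtain ⟨y1, y1n⟩ := bf _ _ (1 / 2) (by norm_num) n31 m31 x hx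
  obtain ⟨y2, y2n⟩ := be _ _ (-1 / 2) (by norm_num) m31 m11 _ y1
  obtain ⟨y3, y3n⟩ := be _ _ (1 / 2) (by norm_num) m11 hmid' _ y2
  obtain ⟨y4, y4n⟩ := be _ _ (3 / 2) (by norm_num) hmid' p31 _ y3
  obtain ⟨z1, -⟩ := be _ _ (-1 / 2) (by norm_num) n31 n11 x hx
  obtain ⟨z2, -⟩ := be _ _ (1 / 2) (by norm_num) n11 q11 _ z1
  obtain ⟨z3, -⟩ := be _ _ (3 / 2) (by norm_num) q11 q31 _ z2
  have z4 := hlast _ z3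
  have y0 := hlastf _ y1
  have hne : (E ^ 3) (F x) ≠ 0 := y4n (y3n (y2n (y1n hx0)))
  have hE4 : (E ^ 4) x = 0 := z4
  have hF2 : (F ^ 2) x = 0 := y0
  have hF3 : (F ^ 3) x = 0 := by
    rw [pow_succ', Module.End.mul_apply, hF2, map_zero]
  have hF4 : (F ^ 4) x = 0 := by
    rw [pow_succ', Module.End.mul_apply, hF3, map_zero]
  have main : (LieAlgebra.ad ℂ L (e + f)) ^ 4 ≠ 0 := by
    intro h
    rw [hEF, hcomm.add_pow] at h
    have h2 := congrArg (fun T : Module.End ℂ L => T x) h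
    have c : ∀ (T : Module.End ℂ L) (n : ℕ), (T * (n : Module.End ℂ L)) x = n • T x := by
      intro T n
      rw [← nsmul_eq_mul']; rfl
    simp only [Finset.sum_range_succ, Finset.sum_range_zero, LinearMap.add_apply, c,
      LinearMap.zero_apply, Module.End.mul_apply, zero_add, pow_zero, Module.End.one_apply,
      Nat.sub_zero, Nat.reduceSub, hE4, hF2, hF3, hF4, map_zero, smul_zero, pow_one,
      add_zero] at h2
    have h4 : Nat.choose 4 3 = 4 := rfl
    rw [h4, ← Nat.cast_smul_eq_nsmul ℂ] at h2
    rcases smul_eq_zero.1 h2 with h | h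
    · norm_num at h
    · exact hne h
  refine ⟨main, ?_⟩
  have hnil : IsNilpotent (LieAlgebra.ad ℂ L (e + f)) := by
    rw [hEF]
    exact hcomm.isNilpotent_add (ad_nilp D hα he) (ad_nilp D hβ hf)
  obtain ⟨N, hN⟩ := hnil
  refine le_csSup ⟨N, ?_⟩ main
  intro n hn
  by_contra hlt
  exact hn (pow_eq_zero_of_le (not_le.1 hlt).le hN)

end lie

end G2Aux

/-- Suppose `𝔤` is the complex simple Lie algebra of type `G₂`.
If `α, β ∈ Φ` are orthogonal roots and `e_α ∈ 𝔤_α`, `e_β ∈ 𝔤_β` are nonzero root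
vectors, then `ad(e_α + e_β)^4 ≠ 0`; in particular `e_α + e_β` has height at
least `4`. -/
theorem g2_orthogonal_ad_pow_four_ne_zero
    {V : Type*} [NormedAddCommGroup V] [InnerProductSpace ℝ V]
    {L : Type*} [LieRing L] [LieAlgebra ℂ L]
    (D : LieRootData V L)
    (hG2 : D.toRootSystemData.IsG2)
    (α β : V) (hα : α ∈ D.roots) (hβ : β ∈ D.roots) (horth : ⟪α, β⟫ = 0)
    (e f : L) (he : e ∈ D.rs α) (he0 : e ≠ 0) (hf : f ∈ D.rs β) (hf0 : f ≠ 0) :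
    (LieAlgebra.ad ℂ L (e + f)) ^ 4 ≠ 0 ∧ 4 ≤ heightOf (e + f) := by
  obtain ⟨hlen, hmid⟩ := G2Aux.orth_pair D.toRootSystemData hG2 hα hβ horth
  rcases hlen with h | h
  · exact G2Aux.core D hα hβ horth h hmid he he0 hf hf0
  · rw [add_comm e f]
    rw [add_comm α β] at hmid
    exact G2Aux.core D hβ hα (by rw [real_inner_comm]; exact horth) h hmid hf hf0 he he0
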